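/- arXiv:1806.11540 — 3 statements merged into one kernel-verified Lean document; each statement's English description precedes it below -/
import Mathlib

section
/- For each i = 1,…,d there is an isomorphism of ℚ̄[G]-modules (V_i ⊗_ℤ ℚ̄) ⊕ ℚ̄ ≅ ℚ̄[G/⟨τ_i⟩], where ℚ̄ carries the trivial G-action, τ_i = h_i^{-1} τ h_i ∈ G, and ℚ̄[G/⟨τ_i⟩] is the permutation module on the left cosets of the order-2 subgroup ⟨τ_i⟩ = {1, τ_i} of G with G acting by left translation. Equivalently, V_i ⊗_ℤ ℚ̄ is isomorphic as a G-representation to the complement of one copy of the trivial representation inside the induced representation Ind_{⟨τ_i⟩}^G 1. -/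
open NumberField TensorProduct

/-- The action of a `ℚ`-automorphism of a number field `H` on the units of its
ring of integers. -/
noncomputable def galU (H : Type*) [Field H] [NumberField H] (g : H ≃ₐ[ℚ] H) :
    (𝓞 H)ˣ ≃* (𝓞 H)ˣ :=
  Units.mapEquiv (galRestrict ℤ ℚ H (𝓞 H) g).toRingEquiv.toMulEquiv

/-- The subgroup `V_i = { ∏_{g ∈ S} (h_i⁻¹(g(η)))^(a_g) : ∑ a_g = 0 }` of `𝓞_H^×`,
here given as a set, with `hi` playing the role of `h_i`. -/
noncomputable def VSet (H : Type*) [Field H] [NumberField H]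
    (S : Finset (H ≃ₐ[ℚ] H)) (η : (𝓞 H)ˣ) (hi : H ≃ₐ[ℚ] H) : Set ((𝓞 H)ˣ) :=
  { u | ∃ a : (H ≃ₐ[ℚ] H) → ℤ,
      (∑ g ∈ S, a g) = 0 ∧ u = ∏ g ∈ S, galU H (hi⁻¹ * g) η ^ a g }

/-- A fixed algebraic closure of `ℚ`. -/
abbrev Qbar : Type := AlgebraicClosure ℚ

/-- `𝓞_H^× ⊗_ℤ ℚ̄` as a `ℚ̄`-vector space. -/
noncomputable abbrev UnitsMod (H : Type*) [Field H] [NumberField H] : Type _ :=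
  Qbar ⊗[ℤ] Additive ((𝓞 H)ˣ)

/-- The `ℚ̄`-linear action of `g ∈ Gal(H/ℚ)` on `𝓞_H^× ⊗_ℤ ℚ̄` induced by the Galois
action on units. -/
noncomputable def actA (H : Type*) [Field H] [NumberField H] (g : H ≃ₐ[ℚ] H) :
    UnitsMod H →ₗ[Qbar] UnitsMod H :=
  LinearMap.baseChange Qbar
    (AddMonoidHom.toIntLinearMap (AddEquiv.toAddMonoidHom (MulEquiv.toAdditive (galU H g))))

/-- `V_i ⊗_ℤ ℚ̄`, realized as the `ℚ̄`-span of the image of `V_i` in `𝓞_H^× ⊗_ℤ ℚ̄`. -/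
noncomputable def VMod (H : Type*) [Field H] [NumberField H]
    (S : Finset (H ≃ₐ[ℚ] H)) (η : (𝓞 H)ˣ) (hi : H ≃ₐ[ℚ] H) :
    Submodule Qbar (UnitsMod H) :=
  Submodule.span Qbar
    ((fun u : (𝓞 H)ˣ => ((1 : Qbar) ⊗ₜ[ℤ] Additive.ofMul u : UnitsMod H)) '' VSet H S η hi)


theorem LA {Q U : Type*} [Fintype Q] [Nonempty Q] [AddCommGroup U] (K : Type*) [Field K] [CharZero K]
    (u : Q → U)
    (hinj : ∀ b : Q → ℤ, ∑ q, b q = 0 → ∑ q, b q • u q = 0 → b = 0) :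
    ∀ f : Q → K, ∑ q, f q = 0 → ∑ q, f q • ((1 : K) ⊗ₜ[ℤ] u q) = 0 → f = 0 := by
  classical
  intro f hf0 hf
  let L : (Q → ℤ) →ₗ[ℤ] U × ℤ := Fintype.linearCombination ℤ (fun q => (u q, (1:ℤ)))
  have hL : Function.Injective L := by
    rw [← LinearMap.ker_eq_bot, LinearMap.ker_eq_bot']
    intro b hb
    have hb' : ∑ q, b q • (u q, (1:ℤ)) = 0 := by
      simpa [L, Fintype.linearCombination_apply] using hb
    apply hinj b
    · simpa [Prod.snd_sum] using congrArg Prod.snd hb'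
    · simpa [Prod.fst_sum] using congrArg Prod.fst hb'
  have : Module.Flat ℤ K := inferInstance
  have hT : Function.Injective (L.baseChange K) :=
    Module.Flat.lTensor_preserves_injective_linearMap (M := K) L hL
  have key : L.baseChange K (∑ q, f q ⊗ₜ[ℤ] (Pi.single q (1:ℤ) : Q → ℤ)) = 0 := by
    have h1 : ∀ q, f q ⊗ₜ[ℤ] (u q, (1:ℤ)) =
        (LinearMap.inl ℤ U ℤ).baseChange K (f q • ((1 : K) ⊗ₜ[ℤ] u q)) +
          f q ⊗ₜ[ℤ] ((0:U), (1:ℤ)) := by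
      intro q
      simp only [TensorProduct.smul_tmul', smul_eq_mul, mul_one, LinearMap.baseChange_tmul,
        ← TensorProduct.tmul_add]
      simp
    rw [map_sum]
    simp only [LinearMap.baseChange_tmul, L, Fintype.linearCombination_apply_single, one_smul]
    rw [Finset.sum_congr rfl (fun q _ => h1 q), Finset.sum_add_distrib, ← map_sum, hf,
      ← TensorProduct.sum_tmul, hf0]
    simp
  have h0 := hT (key.trans (map_zero _).symm)
  have h2 := congrArg (TensorProduct.piScalarRight ℤ ℤ K Q) h0
  funext q
  have h3 := congrFun h2 q
  simpa [TensorProduct.piScalarRight_apply, Finset.sum_apply, Pi.single_apply] using h3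

theorem LA2 {Q U : Type*} [Fintype Q] [Nonempty Q] [AddCommGroup U] (K : Type*) [Field K] [CharZero K]
    (u : Q → U)
    (hinj : ∀ b : Q → ℤ, ∑ q, b q = 0 → ∑ q, b q • u q = 0 → b = 0)
    (M : Submodule K (K ⊗[ℤ] U))
    (hM : M = Submodule.span K ((fun x => (1:K) ⊗ₜ[ℤ] x) ''
      {x | ∃ b : Q → ℤ, ∑ q, b q = 0 ∧ x = ∑ q, b q • u q})) :
    ∃ e : (M × K) ≃ₗ[K] (Q → K), ∀ w c,
      ∑ q, (e (w, c) q - c) = 0 ∧ (w : K ⊗[ℤ] U) = ∑ q, (e (w, c) q - c) • ((1 : K) ⊗ₜ[ℤ] u q) := by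
  classical
  have hK := LA K u hinj
  let sm : (Q → K) →ₗ[K] K := Fintype.linearCombination K (fun _ => (1:K))
  have hsm : ∀ f, sm f = ∑ q, f q := fun f => by simp [sm, Fintype.linearCombination_apply]
  let W := LinearMap.ker sm
  let Φ : (Q → K) →ₗ[K] (K ⊗[ℤ] U) := Fintype.linearCombination K (fun q => (1:K) ⊗ₜ[ℤ] u q)
  have hΦ : ∀ f, Φ f = ∑ q, f q • ((1 : K) ⊗ₜ[ℤ] u q) := fun f => by
    simp [Φ, Fintype.linearCombination_apply]
  have hWM : ∀ f ∈ W, Φ f ∈ M := by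
    intro f hf
    have hf' : ∑ q, f q = 0 := by rw [← hsm]; exact hf
    obtain ⟨q0⟩ := ‹Nonempty Q›
    have : Φ f = ∑ q, f q • ((1 : K) ⊗ₜ[ℤ] (u q - u q0)) := by
      simp only [TensorProduct.tmul_sub, smul_sub, Finset.sum_sub_distrib, ← Finset.sum_smul, hf',
        zero_smul, sub_zero, hΦ]
    rw [this, hM]
    refine Submodule.sum_mem _ fun q _ => Submodule.smul_mem _ _ (Submodule.subset_span ⟨_, ⟨Pi.single q 1 - Pi.single q0 1, ?_, ?_⟩, rfl⟩)
    · simp [Finset.sum_sub_distrib]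
    · simp [sub_smul, Finset.sum_sub_distrib, Pi.single_apply, ite_smul]
  let Ψ : W →ₗ[K] M := (Φ.domRestrict W).codRestrict M (fun f => hWM f f.2)
  have hΨ : Function.Bijective Ψ := by
    constructor
    · rw [← LinearMap.ker_eq_bot, LinearMap.ker_eq_bot']
      intro f hf
      have := congrArg Subtype.val hf
      apply Subtype.ext
      refine hK f.1 ?_ ?_
      · rw [← hsm]; exact f.2
      · rw [← hΦ]; exact this
    · have : M ≤ W.map Φ := by
        rw [hM, Submodule.span_le]
        rintro _ ⟨_, ⟨b, hb, rfl⟩, rfl⟩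
        refine ⟨fun q => (b q : K), ?_, ?_⟩
        · show sm _ = 0
          rw [hsm]; exact_mod_cast hb
        · show _ = (1:K) ⊗ₜ[ℤ] _
          rw [hΦ, TensorProduct.tmul_sum]
          refine Finset.sum_congr rfl fun q _ => ?_
          rw [TensorProduct.tmul_smul, Int.cast_smul_eq_zsmul]
      rintro ⟨m, hm⟩
      obtain ⟨f, hf, rfl⟩ := this hm
      exact ⟨⟨f, hf⟩, rfl⟩
  let A : W × K →ₗ[K] (Q → K) := LinearMap.coprod W.subtype
    (LinearMap.pi fun _ => LinearMap.id)
  have hA : ∀ f c q, A (f, c) q = f.1 q + c := fun f c q => by simp [A]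
  have hcard : (Fintype.card Q : K) ≠ 0 := by exact_mod_cast Fintype.card_ne_zero
  have hAb : Function.Bijective A := by
    constructor
    · rw [← LinearMap.ker_eq_bot, LinearMap.ker_eq_bot']
      rintro ⟨f, c⟩ hfc
      have h1 : ∀ q, f.1 q + c = 0 := fun q => by rw [← hA, hfc]; rfl
      have h2 : ∑ q, f.1 q = 0 := by rw [← hsm]; exact f.2
      have h3 : ∑ q, (f.1 q + c) = 0 := Finset.sum_eq_zero fun q _ => h1 q
      rw [Finset.sum_add_distrib, h2] at h3
      have hc : c = 0 := by simpa using h3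
      subst hc
      refine Prod.ext (Subtype.ext (funext fun q => ?_)) rfl
      simpa using h1 q
    · intro f
      let c : K := (∑ q, f q) / Fintype.card Q
      refine ⟨(⟨fun q => f q - c, ?_⟩, c), ?_⟩
      · show sm _ = 0
        rw [hsm, Finset.sum_sub_distrib]
        simp [c]
        field_simp
        simp
      · funext q; rw [hA]; simp
  let e1 := LinearEquiv.ofBijective Ψ hΨ
  let e2 := LinearEquiv.ofBijective A hAb
  refine ⟨(LinearEquiv.prodCongr e1.symm (LinearEquiv.refl K K)).trans e2, fun w c => ?_⟩
  obtain ⟨f, rfl⟩ := e1.surjective w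
  have : ∀ q, ((LinearEquiv.prodCongr e1.symm (LinearEquiv.refl K K)).trans e2) (e1 f, c) q - c = f.1 q := by
    intro q
    have : ((LinearEquiv.prodCongr e1.symm (LinearEquiv.refl K K)).trans e2) (e1 f, c) = A (f, c) := by
      simp [e2]
    rw [this, hA]; ring
  simp only [this]
  refine ⟨?_, ?_⟩
  · rw [← hsm]; exact f.2
  · rw [← hΦ]; rfl

section grp
variable {Γ : Type*} [Group Γ] (G : Subgroup Γ) (τ k : Γ) (t : G)

theorem mk_cases (hτ2 : τ * τ = 1) (ht : (t : Γ) = k⁻¹ * τ * k) (a b : G)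
    (hab : (a : G ⧸ Subgroup.zpowers t) = b) :
    (b : Γ) * k⁻¹ = a * k⁻¹ ∨ (b : Γ) * k⁻¹ = a * k⁻¹ * τ := by
  rw [QuotientGroup.eq, Subgroup.mem_zpowers_iff] at hab
  obtain ⟨n, hn⟩ := hab
  have htt : t ^ (2:ℤ) = 1 := by
    apply Subtype.ext
    rw [zpow_two]
    simp only [Subgroup.coe_mul, ht, Subgroup.coe_one]
    calc k⁻¹ * τ * k * (k⁻¹ * τ * k) = k⁻¹ * (τ * τ) * k := by group
      _ = 1 := by rw [hτ2]; group
  have hb : b = a * t ^ n := by rw [hn]; group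
  rcases Int.even_or_odd' n with ⟨m, rfl | rfl⟩
  · left
    rw [zpow_mul, htt, one_zpow, mul_one] at hb
    rw [hb]
  · right
    rw [zpow_add, zpow_mul, htt, one_zpow, one_mul, zpow_one] at hb
    rw [hb, Subgroup.coe_mul, ht]
    group

theorem reps_lemma (hτ2 : τ * τ = 1)
    (ht : (t : Γ) = k⁻¹ * τ * k) (R : Finset Γ)
    (hR : ∀ x : Γ, x * k ∈ G → ∃! r, r ∈ R ∧ (r = x ∨ r = x * τ)) :
    ∃ ρ : (G ⧸ Subgroup.zpowers t) → Γ,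
      (∀ q, ρ q ∈ R ∧ ∃ hm : ρ q * k ∈ G, ((⟨ρ q * k, hm⟩ : G) : G ⧸ Subgroup.zpowers t) = q) ∧
      (Function.Injective ρ) ∧ ∀ r ∈ R, r * k ∈ G → ∃ q, ρ q = r := by
  classical
  have hx : ∀ q : G ⧸ Subgroup.zpowers t, ((q.out : Γ) * k⁻¹) * k ∈ G := by
    intro q; simp
  choose ρ hρ hρu using fun q => hR _ (hx q)
  have hρ2 : ∀ q, ∃ hm : ρ q * k ∈ G,
      ((⟨ρ q * k, hm⟩ : G) : G ⧸ Subgroup.zpowers t) = q := by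
    intro q
    rcases (hρ q).2 with e | e
    · have e' : ρ q * k = (q.out : Γ) := by rw [e]; group
      refine ⟨e' ▸ q.out.2, ?_⟩
      have : (⟨ρ q * k, e' ▸ q.out.2⟩ : G) = q.out := Subtype.ext e'
      rw [this, QuotientGroup.out_eq']
    · have e' : ρ q * k = ((q.out * t : G) : Γ) := by
        rw [e, Subgroup.coe_mul, ht]; group
      refine ⟨e' ▸ (q.out * t).2, ?_⟩
      have : (⟨ρ q * k, e' ▸ (q.out * t).2⟩ : G) = q.out * t := Subtype.ext e'
      rw [this]
      conv_rhs => rw [← QuotientGroup.out_eq' q]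
      rw [QuotientGroup.eq]
      simp
  refine ⟨ρ, fun q => ⟨(hρ q).1, hρ2 q⟩, ?_, ?_⟩
  · intro q q' hqq
    obtain ⟨h1, h2⟩ := hρ2 q
    obtain ⟨h3, h4⟩ := hρ2 q'
    rw [← h2, ← h4]
    congr 2
    rw [hqq]
  · intro r hr hrk
    let q : G ⧸ Subgroup.zpowers t := ((⟨r * k, hrk⟩ : G) : G ⧸ Subgroup.zpowers t)
    refine ⟨q, ?_⟩
    symm
    apply hρu q r
    refine ⟨hr, ?_⟩
    have := mk_cases G τ k t hτ2 ht q.out ⟨r * k, hrk⟩ (QuotientGroup.out_eq' q)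
    simpa using this
end grp

theorem reps_sum {Γ Q X : Type*} [Fintype Q] [AddCommMonoid X] (R : Finset Γ) (ρ : Q → Γ)
    (P : Γ → Prop) (hinj : Function.Injective ρ) (hmem : ∀ q, ρ q ∈ R)
    (hsurj : ∀ r ∈ R, P r → ∃ q, ρ q = r) (f : Γ → X) (hf : ∀ r ∈ R, ¬ P r → f r = 0) :
    ∑ r ∈ R, f r = ∑ q, f (ρ q) := by
  classical
  rw [← Finset.sum_image (f := f) (g := ρ) (s := Finset.univ) (fun a _ b _ hab => hinj hab)]
  symm
  apply Finset.sum_subset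
  · intro r hr
    obtain ⟨q, -, rfl⟩ := Finset.mem_image.1 hr
    exact hmem q
  · intro r hr hr'
    apply hf r hr
    intro hrk
    apply hr'
    obtain ⟨q, hq⟩ := hsurj r hr hrk
    exact Finset.mem_image.2 ⟨q, Finset.mem_univ _, hq⟩


theorem tmul_cast {Q U : Type*} [Fintype Q] [AddCommGroup U] (K : Type*) [Field K]
    (u : Q → U) (c : Q → ℤ) : (1 : K) ⊗ₜ[ℤ] (∑ q, c q • u q) =
      ∑ q, (c q : K) • ((1 : K) ⊗ₜ[ℤ] u q) := by
  rw [TensorProduct.tmul_sum]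
  refine Finset.sum_congr rfl fun q _ => ?_
  rw [TensorProduct.tmul_smul, Int.cast_smul_eq_zsmul]

theorem galU_mul (H : Type*) [Field H] [NumberField H] (a b : H ≃ₐ[ℚ] H) (x : (𝓞 H)ˣ) :
    galU H (a * b) x = galU H a (galU H b x) := by
  ext
  simp [galU]

theorem galU_one (H : Type*) [Field H] [NumberField H] (x : (𝓞 H)ˣ) :
    galU H 1 x = x := by
  ext
  simp [galU]

theorem actA_tmul (H : Type*) [Field H] [NumberField H] (g : H ≃ₐ[ℚ] H) (c : Qbar) (x : (𝓞 H)ˣ) :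
    actA H g (c ⊗ₜ[ℤ] Additive.ofMul x) = c ⊗ₜ[ℤ] Additive.ofMul (galU H g x) := rfl

theorem actA_actA (H : Type*) [Field H] [NumberField H] (g : H ≃ₐ[ℚ] H) (x : UnitsMod H) :
    actA H g (actA H g⁻¹ x) = x := by
  induction x using TensorProduct.induction_on with
  | zero => simp
  | add x y hx hy => rw [map_add, map_add, hx, hy]
  | tmul c x =>
    have := actA_tmul H g⁻¹ c x.toMul
    rw [ofMul_toMul] at this
    rw [this, actA_tmul, ← galU_mul, mul_inv_cancel, galU_one, ofMul_toMul]

/-- For each `i` there is an isomorphism of `ℚ̄[G]`-modules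
`(V_i ⊗_ℤ ℚ̄) ⊕ ℚ̄ ≅ ℚ̄[G/⟨τᵢ⟩]`, where `ℚ̄` carries the trivial `G`-action, and
`ℚ̄[G/⟨τᵢ⟩]` is the permutation module on the left cosets of `⟨τᵢ⟩ = {1, τᵢ}` with `G`
acting by left translation.  The `G`-stability of `V_i ⊗ ℚ̄` and the `ℚ̄[G]`-linearity
of the `ℚ̄`-linear equivalence `e` are expressed by the displayed conditions. -/
theorem stmt_4 (H : Type*) [Field H] [NumberField H] [IsGalois ℚ H]
    (hH : (H →+* ℝ) → False)
    (ι : H →+* ℂ) (τ : H ≃ₐ[ℚ] H)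
    (hιτ : ∀ x : H, ι (τ x) = starRingEnd ℂ (ι x))
    (hτ2 : τ * τ = 1) (hτ1 : τ ≠ 1)
    -- `G = Gal(H/F)` for a totally real subfield `F ⊆ H`, Galois over `ℚ`, of degree `d`
    (d : ℕ) (hd : 0 < d)
    (Gsub : Subgroup (H ≃ₐ[ℚ] H)) [Gsub.Normal] (hGd : Gsub.index = d)
    (hτG : τ ∈ Gsub)
    -- representatives of the left cosets of `G` in `Gal(H/ℚ)`, with `h 0 = 1`
    (h : Fin d → (H ≃ₐ[ℚ] H)) (hreps : ∀ g : H ≃ₐ[ℚ] H, ∃! i : Fin d, (h i)⁻¹ * g ∈ Gsub)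
    (h1 : h ⟨0, hd⟩ = 1)
    -- the Minkowski unit `η`
    (η : (𝓞 H)ˣ) (hητ : galU H τ η = η)
    (T : Finset (H ≃ₐ[ℚ] H))
    (hT : ∀ g : H ≃ₐ[ℚ] H, ∃! t, t ∈ T ∧ (t = g ∨ t = g * τ))
    (hηT : (∏ g ∈ T, galU H g η) = 1)
    (hηker : ∀ a : (H ≃ₐ[ℚ] H) → ℤ,
      (∏ g ∈ T, galU H g η ^ a g) = 1 ↔ ∃ c : ℤ, ∀ g ∈ T, a g = c)
    -- representatives of the left cosets of `{1, τ}` in `G`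
    (S : Finset (H ≃ₐ[ℚ] H)) (hSG : ∀ s ∈ S, s ∈ Gsub)
    (hS : ∀ g ∈ Gsub, ∃! s, s ∈ S ∧ (s = g ∨ s = g * τ))
    -- the index `i` and the membership `τᵢ = hᵢ⁻¹ τ hᵢ ∈ G`
    (i : Fin d) (hτi : (h i)⁻¹ * τ * h i ∈ Gsub) :
    (∀ g ∈ Gsub,
      Submodule.map (actA H g) (VMod H S η (h i)) = VMod H S η (h i)) ∧
    ∃ e : (↥(VMod H S η (h i)) × Qbar) ≃ₗ[Qbar]
        ((↥Gsub ⧸ Subgroup.zpowers (⟨(h i)⁻¹ * τ * h i, hτi⟩ : ↥Gsub)) → Qbar),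
      ∀ (g : ↥Gsub) (w w' : ↥(VMod H S η (h i))) (c : Qbar),
        (w' : UnitsMod H) = actA H ↑g ↑w →
        ∀ q : ↥Gsub ⧸ Subgroup.zpowers (⟨(h i)⁻¹ * τ * h i, hτi⟩ : ↥Gsub),
          e (w', c) q = e (w, c) (g⁻¹ • q) := by
  classical
  set k := h i with hk
  set t : ↥Gsub := ⟨k⁻¹ * τ * k, hτi⟩ with htdef
  have ht : (t : H ≃ₐ[ℚ] H) = k⁻¹ * τ * k := rfl
  let Q := ↥Gsub ⧸ Subgroup.zpowers t
  have : Fintype Q := Fintype.ofFinite _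
  -- the function `v` on the Galois group
  let v : (H ≃ₐ[ℚ] H) → Additive (𝓞 H)ˣ := fun g => Additive.ofMul (galU H g η)
  have hv : ∀ g, v (g * τ) = v g := fun g => by simp only [v, galU_mul, hητ]
  let u : Q → Additive (𝓞 H)ˣ := fun q => v ((q.out : H ≃ₐ[ℚ] H) * k⁻¹)
  have hu : ∀ a : ↥Gsub, u (a : Q) = v ((a : H ≃ₐ[ℚ] H) * k⁻¹) := by
    intro a
    rcases mk_cases Gsub τ k t hτ2 ht a (Quotient.out (a : Q)) (QuotientGroup.out_eq' (a : Q)).symm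
      with e | e
    · simp only [u, e]
    · simp only [u, e, hv]
  have huρ : ∀ (r : H ≃ₐ[ℚ] H) (q : Q) (hm : r * k ∈ Gsub),
      ((⟨r * k, hm⟩ : ↥Gsub) : Q) = q → v r = u q := by
    rintro r q hm rfl
    rw [hu]
    simp
  let ext : (Q → ℤ) → (H ≃ₐ[ℚ] H) → ℤ := fun b r =>
    if hm : r * k ∈ Gsub then b ((⟨r * k, hm⟩ : ↥Gsub) : Q) else 0
  have hext0 : ∀ b r, r * k ∉ Gsub → ext b r = 0 := fun b r hr => by simp [ext, hr]
  have hextq : ∀ b r q (hm : r * k ∈ Gsub), ((⟨r * k, hm⟩ : ↥Gsub) : Q) = q → ext b r = b q := by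
    rintro b r q hm rfl
    simp [ext, hm]
  -- independence
  obtain ⟨ρ, hρ, hρi, hρs⟩ := reps_lemma Gsub τ k t hτ2 ht T (fun x _ => hT x)
  have hinj : ∀ b : Q → ℤ, ∑ q, b q = 0 → ∑ q, b q • u q = 0 → b = 0 := by
    intro b hb0 hb
    have h2 : ∑ r ∈ T, ext b r • v r = 0 := by
      rw [reps_sum T ρ (fun r => r * k ∈ Gsub) hρi (fun q => (hρ q).1) hρs (fun r => ext b r • v r) (fun r _ hr => by rw [hext0 b r hr, zero_smul]), ← hb]
      refine Finset.sum_congr rfl fun q _ => ?_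
      obtain ⟨-, hm, hq⟩ := hρ q
      rw [hextq b _ q hm hq, huρ _ q hm hq]
    have h3 : (∏ g ∈ T, galU H g η ^ ext b g) = 1 := by
      have := congrArg Additive.toMul h2
      simpa [toMul_sum, v] using this
    obtain ⟨c, hc⟩ := (hηker _).1 h3
    have h4 : ∀ q, b q = c := by
      intro q
      obtain ⟨hmT, hm, hq⟩ := hρ q
      rw [← hextq b _ q hm hq, hc _ hmT]
    simp only [h4] at hb0
    have hc0 : c = 0 := by
      have : Fintype.card Q ≠ 0 := Fintype.card_ne_zero
      simpa [this] using hb0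
    funext q
    rw [h4, hc0]; rfl
  -- description of `V`
  have hkey : ∀ s, s ∈ Gsub ↔ k⁻¹ * s * k ∈ Gsub := by
    intro s
    constructor
    · intro hs
      simpa using (inferInstance : Gsub.Normal).conj_mem s hs k⁻¹
    · intro hs
      have := (inferInstance : Gsub.Normal).conj_mem _ hs k
      have e : k * (k⁻¹ * s * k) * k⁻¹ = s := by group
      rwa [e] at this
  let R : Finset (H ≃ₐ[ℚ] H) := S.map (Equiv.mulLeft k⁻¹).toEmbedding
  have hRmem : ∀ r, r ∈ R ↔ k * r ∈ S := by
    intro r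
    simp only [R, Finset.mem_map_equiv, Equiv.mulLeft_symm_apply, inv_inv]
    try simp
  obtain ⟨σ, hσ, hσi, hσs⟩ := reps_lemma Gsub τ k t hτ2 ht R (by
    intro x hx
    have hx' : k * x ∈ Gsub := by
      rw [hkey]
      simpa [mul_assoc] using hx
    obtain ⟨s, ⟨hs1, hs2⟩, hs3⟩ := hS _ hx'
    refine ⟨k⁻¹ * s, ⟨?_, ?_⟩, ?_⟩
    · rw [hRmem]; simpa using hs1
    · rcases hs2 with rfl | rfl
      · left; group
      · right; group
    · rintro r ⟨hr1, hr2⟩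
      have := hs3 (k * r) ⟨(hRmem r).1 hr1, by
        rcases hr2 with rfl | rfl
        · left; rfl
        · right; group⟩
      rw [← this]; group)
  have hRG : ∀ r ∈ R, r * k ∈ Gsub := by
    intro r hr
    have := (hkey _).1 (hSG _ ((hRmem r).1 hr))
    simpa using this
  have hsumS : ∀ (f : (H ≃ₐ[ℚ] H) → Additive (𝓞 H)ˣ),
      ∑ s ∈ S, f (k⁻¹ * s) = ∑ q, f (σ q) := by
    intro f
    rw [← reps_sum R σ (fun r => r * k ∈ Gsub) hσi (fun q => (hσ q).1) hσs f (fun r hr hr' => absurd (hRG r hr) hr')]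
    simp [R]
  have hsumX : ∀ (f : (H ≃ₐ[ℚ] H) → ℤ), ∑ s ∈ S, f (k⁻¹ * s) = ∑ q, f (σ q) := by
    intro f
    rw [← reps_sum R σ (fun r => r * k ∈ Gsub) hσi (fun q => (hσ q).1) hσs f (fun r hr hr' => absurd (hRG r hr) hr')]
    simp [R]
  have hV : ∀ x : (𝓞 H)ˣ, x ∈ VSet H S η k ↔
      ∃ b : Q → ℤ, ∑ q, b q = 0 ∧ Additive.ofMul x = ∑ q, b q • u q := by
    intro x
    have hprod : ∀ a : (H ≃ₐ[ℚ] H) → ℤ, (x = ∏ g ∈ S, galU H (k⁻¹ * g) η ^ a g) ↔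
        Additive.ofMul x = ∑ q, a (k * σ q) • u q := by
      intro a
      have e : Additive.ofMul (∏ g ∈ S, galU H (k⁻¹ * g) η ^ a g) = ∑ q, a (k * σ q) • u q := by
        rw [ofMul_prod]
        have := hsumS (fun r => a (k * r) • v r)
        simp only [mul_inv_cancel_left] at this
        refine Eq.trans ?_ (this.trans ?_)
        · rfl
        · refine Finset.sum_congr rfl fun q _ => ?_
          obtain ⟨-, hm, hq⟩ := hσ q
          rw [huρ _ q hm hq]
      rw [← e]
      exact Additive.ofMul.injective.eq_iff.symm
    constructor
    · rintro ⟨a, ha, hx⟩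
      refine ⟨fun q => a (k * σ q), ?_, (hprod a).1 hx⟩
      rw [← hsumX (fun r => a (k * r)), ← ha]
      simp
    · rintro ⟨b, hb, hx⟩
      have hbσ : ∀ q, ext b (k⁻¹ * (k * σ q)) = b q := by
        intro q
        obtain ⟨-, hm, hq⟩ := hσ q
        rw [inv_mul_cancel_left, hextq b _ q hm hq]
      refine ⟨fun s => ext b (k⁻¹ * s), ?_, (hprod _).2 ?_⟩
      · rw [hsumX (ext b), ← hb]
        refine Finset.sum_congr rfl fun q _ => ?_
        simpa using hbσ q
      · simp only [hbσ]; exact hx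
  have hM : VMod H S η k = Submodule.span Qbar ((fun x => (1:Qbar) ⊗ₜ[ℤ] x) ''
      {x | ∃ b : Q → ℤ, ∑ q, b q = 0 ∧ x = ∑ q, b q • u q}) := by
    rw [VMod]
    congr 1
    ext y
    constructor
    · rintro ⟨x, hx, rfl⟩
      exact ⟨Additive.ofMul x, (hV x).1 hx, rfl⟩
    · rintro ⟨x, hx, rfl⟩
      exact ⟨x.toMul, (hV _).2 hx, rfl⟩
  have hactu : ∀ (g : ↥Gsub) (q : Q),
      actA H (g : H ≃ₐ[ℚ] H) ((1 : Qbar) ⊗ₜ[ℤ] u q) = (1 : Qbar) ⊗ₜ[ℤ] u (g • q) := by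
    intro g q
    obtain ⟨a, rfl⟩ := QuotientGroup.mk_surjective q
    have : g • (a : Q) = ((g * a : ↥Gsub) : Q) := rfl
    rw [this, hu, hu]
    simp only [v]
    rw [actA_tmul, ← galU_mul, Subgroup.coe_mul, mul_assoc]
  have hact : ∀ (g : ↥Gsub) (f : Q → Qbar),
      actA H (g : H ≃ₐ[ℚ] H) (∑ q, f q • ((1 : Qbar) ⊗ₜ[ℤ] u q)) =
        ∑ q, f (g⁻¹ • q) • ((1 : Qbar) ⊗ₜ[ℤ] u q) := by
    intro g f
    rw [map_sum, ← Equiv.sum_comp (MulAction.toPerm g : Equiv.Perm Q)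
      (fun q => f (g⁻¹ • q) • ((1 : Qbar) ⊗ₜ[ℤ] u q))]
    refine Finset.sum_congr rfl fun q _ => ?_
    rw [map_smul, hactu]
    simp
  obtain ⟨e, he⟩ := LA2 Qbar u hinj (VMod H S η k) hM
  have hle : ∀ g ∈ Gsub, Submodule.map (actA H g) (VMod H S η k) ≤ VMod H S η k := by
    intro g hg
    rw [hM, Submodule.map_span, Submodule.span_le]
    rintro _ ⟨_, ⟨_, ⟨b, hb, rfl⟩, rfl⟩, rfl⟩
    apply Submodule.subset_span
    refine ⟨_, ⟨fun q => b ((⟨g, hg⟩ : ↥Gsub)⁻¹ • q), ?_, rfl⟩, ?_⟩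
    · rw [← hb]
      exact Equiv.sum_comp (MulAction.toPerm (⟨g, hg⟩ : ↥Gsub)⁻¹ : Equiv.Perm Q) b
    · have hcast : ∀ c : Q → ℤ, (1 : Qbar) ⊗ₜ[ℤ] (∑ q, c q • u q) =
          ∑ q, (c q : Qbar) • ((1 : Qbar) ⊗ₜ[ℤ] u q) := by
        intro c
        exact tmul_cast Qbar u c
      show (1 : Qbar) ⊗ₜ[ℤ] _ = actA H g ((1 : Qbar) ⊗ₜ[ℤ] _)
      rw [hcast, hcast]
      exact (hact ⟨g, hg⟩ (fun q => (b q : Qbar))).symm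
  refine ⟨fun g hg => le_antisymm (hle g hg) ?_, e, ?_⟩
  · intro x hx
    refine ⟨actA H g⁻¹ x, hle g⁻¹ (inv_mem hg) ⟨x, hx, rfl⟩, actA_actA H g x⟩
  · intro g w w' c hww q
    obtain ⟨p1, p2⟩ := he w c
    obtain ⟨p3, p4⟩ := he w' c
    have hz := LA Qbar u hinj (fun q => (e (w', c) q - c) - (e (w, c) (g⁻¹ • q) - c)) (by
        have p5 : ∑ q : Q, (e (w, c) (g⁻¹ • q) - c) = ∑ q : Q, (e (w, c) q - c) :=
          Equiv.sum_comp (MulAction.toPerm g⁻¹ : Equiv.Perm Q) (fun q => e (w, c) q - c)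
        rw [Finset.sum_sub_distrib, p3, p5, p1, sub_zero]) (by
        simp only [sub_smul (_ - _) (_ - _)]
        rw [Finset.sum_sub_distrib, ← p4, hww, sub_eq_zero, ← hact g (fun q => e (w, c) q - c), ← p2])
    have := congrFun hz q
    simp only [Pi.zero_apply] at this
    linear_combination this
end

section
/- There is an isomorphism of ℚ̄[G]-modules (𝓞_H^× ⊗_ℤ ℚ̄) ⊕ ℚ̄ ≅ ⊕_{i=1}^d ℚ̄[G/⟨τ_i⟩], where the G-action on 𝓞_H^× ⊗_ℤ ℚ̄ is induced by the Galois action on units, ℚ̄ carries the trivial G-action, and ℚ̄[G/⟨τ_i⟩] is the permutation module on the left cosets of the order-2 subgroup ⟨τ_i⟩ = {1, τ_i} of G with G acting by left translation. -/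
open NumberField TensorProduct

section aux
variable {H : Type*} [Field H] [NumberField H]

lemma coe_galU (g : H ≃ₐ[ℚ] H) (u : (𝓞 H)ˣ) :
    (((galU H g u : (𝓞 H)ˣ) : 𝓞 H) : H) = g ((u : 𝓞 H) : H) := by
  simpa [galU] using algebraMap_galRestrict_apply ℤ g (u : 𝓞 H)

lemma units_ext' {u v : (𝓞 H)ˣ} (h : ((u : 𝓞 H) : H) = ((v : 𝓞 H) : H)) : u = v :=
  Units.ext (RingOfIntegers.ext h)

lemma galU_mul_s5 (g k : H ≃ₐ[ℚ] H) (u : (𝓞 H)ˣ) :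
    galU H (g * k) u = galU H g (galU H k u) := by
  apply units_ext'
  simp [coe_galU]

lemma galU_one_s5 (u : (𝓞 H)ˣ) : galU H 1 u = u := by
  apply units_ext'
  simp [coe_galU]

/-- The logarithm of the absolute value of a unit at a complex embedding. -/
noncomputable def logAt (ι : H →+* ℂ) (u : (𝓞 H)ˣ) : ℝ := Real.log ‖ι ((u : 𝓞 H) : H)‖

lemma norm_ne (ι : H →+* ℂ) (u : (𝓞 H)ˣ) : ‖ι ((u : 𝓞 H) : H)‖ ≠ 0 := by
  simp

lemma logAt_mul (ι : H →+* ℂ) (u v : (𝓞 H)ˣ) : logAt ι (u * v) = logAt ι u + logAt ι v := by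
  unfold logAt
  rw [← Real.log_mul (norm_ne ι u) (norm_ne ι v)]
  simp

/-- `logAt` as an additive homomorphism. -/
noncomputable def logHom (ι : H →+* ℂ) : Additive (𝓞 H)ˣ →+ ℝ where
  toFun u := logAt ι u.toMul
  map_zero' := by simp [logAt]
  map_add' u v := logAt_mul ι _ _

lemma zpowers_mem {G : Type*} [Group G] {t x : G} (ht : t * t = 1) :
    x ∈ Subgroup.zpowers t ↔ x = 1 ∨ x = t := by
  constructor
  · rintro ⟨n, rfl⟩
    have h2 : t ^ (2 : ℤ) = 1 := by rw [zpow_two, ht]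
    rcases Int.even_or_odd' n with ⟨k, rfl | rfl⟩
    · left; simp [zpow_mul, h2]
    · right; simp [zpow_add, zpow_mul, h2]
  · rintro (rfl | rfl)
    · exact one_mem _
    · exact Subgroup.mem_zpowers _

lemma exists_eps (ι : H →+* ℂ) (τ : H ≃ₐ[ℚ] H)
    (hιτ : ∀ x : H, ι (τ x) = starRingEnd ℂ (ι x)) (hτ2 : τ * τ = 1) :
    ∃ ε : ((H ≃ₐ[ℚ] H) ⧸ Subgroup.zpowers τ) → (𝓞 H)ˣ,
      (∀ σ s, ε (σ • s) = galU H σ (ε s)) ∧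
      (∀ s, s ≠ ((1 : H ≃ₐ[ℚ] H) : (H ≃ₐ[ℚ] H) ⧸ Subgroup.zpowers τ) → logAt ι (ε s) < 0) := by
  obtain ⟨u, hu⟩ := Units.dirichletUnitTheorem.exists_unit H (InfinitePlace.mk ι)
  have key : ∀ σ : H ≃ₐ[ℚ] H, σ ∉ Subgroup.zpowers τ → logAt ι (galU H σ u) < 0 := by
    intro σ hσ
    have := hu (InfinitePlace.mk (ι.comp (σ : H →+* H))) ?_
    · simpa [logAt, coe_galU] using this
    · intro h
      apply hσ
      rw [zpowers_mem hτ2]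
      rcases InfinitePlace.mk_eq_iff.mp h with h | h
      · left
        ext x
        exact ι.injective (by simpa using congrArg (fun f => f x) h)
      · right
        have : τ * σ = 1 := by
          ext x
          apply ι.injective
          have := congrArg (fun f => f x) h
          simpa [hιτ, ComplexEmbedding.conjugate] using this
        calc σ = τ * τ * σ := by rw [hτ2, one_mul]
          _ = τ := by rw [mul_assoc, this, mul_one]
  have hfix : galU H τ (u * galU H τ u) = u * galU H τ u := by
    rw [map_mul, ← galU_mul_s5, hτ2, galU_one_s5, mul_comm]
  refine ⟨Quotient.lift (fun σ => galU H σ (u * galU H τ u)) ?_, ?_, ?_⟩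
  · intro a b hab
    have hab' : a⁻¹ * b ∈ Subgroup.zpowers τ := QuotientGroup.leftRel_apply.mp hab
    rw [zpowers_mem hτ2] at hab'
    have : b = a * (a⁻¹ * b) := by group
    rcases hab' with h | h
    · rw [h, mul_one] at this; rw [this]
    · rw [h] at this
      simp only [this]
      rw [galU_mul_s5, hfix]
  · intro σ s
    induction s using QuotientGroup.induction_on with
    | H a => exact galU_mul_s5 σ a _
  · intro s
    induction s using QuotientGroup.induction_on with
    | H a =>
      intro hs
      have ha : a ∉ Subgroup.zpowers τ := by
        intro h
        apply hs
        rw [eq_comm, QuotientGroup.eq]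
        simpa using h
      change logAt ι (galU H a (u * galU H τ u)) < 0
      rw [map_mul, logAt_mul, ← galU_mul_s5]
      refine add_neg (key a ha) (key _ ?_)
      intro h
      exact ha ((Subgroup.mul_mem_cancel_right _ (Subgroup.mem_zpowers τ)).mp h)

lemma logAt_eq_zero_of_fixed [IsGalois ℚ H] (ι : H →+* ℂ) (u : (𝓞 H)ˣ)
    (hu : ∀ σ, galU H σ u = u) : logAt ι u = 0 := by
  have h1 := Algebra.norm_eq_prod_automorphisms (K := ℚ) ((u : 𝓞 H) : H)
  have h2 : ∀ σ : H ≃ₐ[ℚ] H, σ ((u : 𝓞 H) : H) = ((u : 𝓞 H) : H) := by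
    intro σ; rw [← coe_galU, hu]
  simp only [h2, Finset.prod_const] at h1
  have h3 := congrArg (fun x => ‖ι x‖) h1
  simp only [eq_ratCast, map_ratCast, map_pow, norm_pow] at h3
  have h4 : ‖((Algebra.norm ℚ ((u : 𝓞 H) : H) : ℚ) : ℂ)‖ = 1 := by
    have := NumberField.Units.norm H u
    rw [Complex.norm_ratCast]
    exact_mod_cast this
  rw [h4] at h3
  have h5 : ‖ι ((u : 𝓞 H) : H)‖ = 1 :=
    (pow_eq_one_iff_of_nonneg (norm_nonneg _) (by simp [Finset.card_univ])).mp h3.symm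
  simp [logAt, h5]

lemma finrank_unitsMod : Module.finrank Qbar (UnitsMod H) = Units.rank H := by
  rw [← Units.finrank_eq]
  exact (TensorProduct.isBaseChange ℤ (Additive (𝓞 H)ˣ) Qbar).finrank_eq

lemma linInd [IsGalois ℚ H] (ι : H →+* ℂ) (τ : H ≃ₐ[ℚ] H)
    (ε : ((H ≃ₐ[ℚ] H) ⧸ Subgroup.zpowers τ) → (𝓞 H)ˣ)
    (h1 : ∀ σ s, ε (σ • s) = galU H σ (ε s))
    (h2 : ∀ s, s ≠ ((1 : H ≃ₐ[ℚ] H) : (H ≃ₐ[ℚ] H) ⧸ Subgroup.zpowers τ) → logAt ι (ε s) < 0) :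
    LinearIndependent ℤ (fun s => ((Additive.ofMul (ε s), 1) : Additive (𝓞 H)ˣ × ℤ)) := by
  classical
  have : Fintype ((H ≃ₐ[ℚ] H) ⧸ Subgroup.zpowers τ) := Fintype.ofFinite _
  rw [Fintype.linearIndependent_iff]
  intro n hn
  have hsum : ∑ s, logAt ι (ε s) = 0 := by
    have e1 : logAt ι (∏ s, ε s) = ∑ s, logAt ι (ε s) := by
      have := map_sum (logHom ι) (fun s => Additive.ofMul (ε s)) Finset.univ
      rw [← ofMul_prod] at this
      exact this
    rw [← e1]
    apply logAt_eq_zero_of_fixed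
    intro σ
    rw [map_prod]
    simp only [← h1]
    exact Equiv.prod_comp (MulAction.toPerm σ) ε
  have hn1 : ∑ s, n s • Additive.ofMul (ε s) = 0 := by
    simpa [Prod.fst_sum] using congrArg Prod.fst hn
  have hn2 : ∑ s, n s = 0 := by
    simpa [Prod.snd_sum] using congrArg Prod.snd hn
  obtain ⟨s, hs⟩ := Finite.exists_max n
  have hconst : ∀ t, n t = n s := by
    obtain ⟨σ, rfl⟩ := QuotientGroup.mk_surjective s
    have hσ : ∀ t, σ⁻¹ • t ≠ ((1 : H ≃ₐ[ℚ] H) : (H ≃ₐ[ℚ] H) ⧸ Subgroup.zpowers τ) ↔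
        t ≠ (σ : (H ≃ₐ[ℚ] H) ⧸ Subgroup.zpowers τ) := by
      intro t
      rw [Ne, inv_smul_eq_iff, MulAction.Quotient.smul_coe, smul_eq_mul, mul_one]
    have e2 : ∑ t, (n t : ℝ) * logAt ι (ε (σ⁻¹ • t)) = 0 := by
      have := congrArg (fun x => logHom ι ((MulEquiv.toAdditive (galU H σ⁻¹)) x)) hn1
      simp only [map_sum, map_zsmul, map_zero] at this
      rw [← this]
      apply Finset.sum_congr rfl
      intro t _
      rw [zsmul_eq_mul, h1]
      rfl
    have e3 : ∑ t, logAt ι (ε (σ⁻¹ • t)) = 0 := by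
      rw [← hsum]
      exact Equiv.sum_comp (MulAction.toPerm σ⁻¹) (fun t => logAt ι (ε t))
    have e4 : ∑ t, ((n t : ℝ) - n σ) * logAt ι (ε (σ⁻¹ • t)) = 0 := by
      simp only [sub_mul, Finset.sum_sub_distrib, ← Finset.mul_sum, e2, e3]
      simp
    have e5 : ∀ t, 0 ≤ ((n t : ℝ) - n σ) * logAt ι (ε (σ⁻¹ • t)) := by
      intro t
      by_cases ht : t = σ
      · simp [ht]
      · apply mul_nonneg_of_nonpos_of_nonpos
        · have := hs t
          have : (n t : ℝ) ≤ n σ := by exact_mod_cast this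
          linarith
        · exact (h2 _ ((hσ t).mpr ht)).le
    intro t
    by_cases ht : t = σ
    · rw [ht]
    · have := (Finset.sum_eq_zero_iff_of_nonneg (fun t _ => e5 t)).mp e4 t (Finset.mem_univ _)
      rcases mul_eq_zero.mp this with h | h
      · have : (n t : ℝ) = n σ := by linarith
        exact_mod_cast this
      · exact absurd h (h2 _ ((hσ t).mpr ht)).ne
  simp only [hconst, Finset.sum_const, Finset.card_univ, nsmul_eq_mul] at hn2
  intro t
  rw [hconst]
  rcases mul_eq_zero.mp hn2 with h | h
  · have := Fintype.card_pos_iff.mpr ⟨s⟩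
    norm_cast at h
    omega
  · exact h

lemma card_S [IsGalois ℚ H] (hH : (H →+* ℝ) → False) (τ : H ≃ₐ[ℚ] H)
    (hτ2 : τ * τ = 1) (hτ1 : τ ≠ 1) :
    Nat.card ((H ≃ₐ[ℚ] H) ⧸ Subgroup.zpowers τ) = Fintype.card (InfinitePlace H) := by
  have : IsTotallyComplex H := by
    refine ⟨fun v => ?_⟩
    by_contra h
    rw [InfinitePlace.not_isComplex_iff_isReal] at h
    exact hH (InfinitePlace.embedding_of_isReal h)
  have h1 := IsTotallyComplex.finrank (K := H)
  have h2 := InfinitePlace.card_eq_nrRealPlaces_add_nrComplexPlaces H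
  have h3 : InfinitePlace.nrRealPlaces H = 0 := by simp
  have h4 := IsGalois.card_aut_eq_finrank ℚ H
  have h5 := Subgroup.card_eq_card_quotient_mul_card_subgroup (Subgroup.zpowers τ)
  have h6 : orderOf τ = 2 := orderOf_eq_prime (by rw [pow_two, hτ2]) hτ1
  rw [Nat.card_zpowers, h6] at h5
  omega

lemma linInd_baseChange (R K : Type*) {A I : Type*} [CommRing R] [CommRing K] [Algebra R K]
    [Module.Flat R K] [AddCommGroup A] [Module R A] (v : I → A)
    (li : LinearIndependent R (fun s => ((v s, 1) : A × R))) :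
    LinearIndependent K (fun s => (((1 : K) ⊗ₜ[R] v s, 1) : (K ⊗[R] A) × K)) := by
  have li2 : LinearIndependent K (fun s => (1 : K) ⊗ₜ[R] ((v s, 1) : A × R)) :=
    Module.Flat.linearIndependent_one_tmul li
  let E : K ⊗[R] (A × R) ≃ₗ[K] (K ⊗[R] A) × K :=
    (TensorProduct.prodRight R K K _ _).trans
      (LinearEquiv.prodCongr (LinearEquiv.refl _ _) (TensorProduct.AlgebraTensorModule.rid R K K))
  have := li2.map' E.toLinearMap E.ker
  have hE : (E.toLinearMap ∘ fun s => (1 : K) ⊗ₜ[R] ((v s, 1) : A × R)) =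
      (fun s => (((1 : K) ⊗ₜ[R] v s, 1) : (K ⊗[R] A) × K)) := by
    funext s
    simp [E]
  rw [hE] at this
  exact this

lemma exists_basis [IsGalois ℚ H] (hH : (H →+* ℝ) → False)
    (ι : H →+* ℂ) (τ : H ≃ₐ[ℚ] H)
    (hιτ : ∀ x : H, ι (τ x) = starRingEnd ℂ (ι x)) (hτ2 : τ * τ = 1) (hτ1 : τ ≠ 1) :
    ∃ b : Module.Basis ((H ≃ₐ[ℚ] H) ⧸ Subgroup.zpowers τ) Qbar (UnitsMod H × Qbar),
      ∀ (σ : H ≃ₐ[ℚ] H) s, (actA H σ (b s).1, (b s).2) = b (σ • s) := by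
  classical
  have : Fintype ((H ≃ₐ[ℚ] H) ⧸ Subgroup.zpowers τ) := Fintype.ofFinite _
  obtain ⟨ε, h1, h2⟩ := exists_eps ι τ hιτ hτ2
  have li := linInd ι τ ε h1 h2
  have li3 : LinearIndependent Qbar (fun s => (((1 : Qbar) ⊗ₜ[ℤ] Additive.ofMul (ε s), 1) :
      UnitsMod H × Qbar)) := by
    apply linInd_baseChange ℤ Qbar
    convert li
  have hfin : Fintype.card ((H ≃ₐ[ℚ] H) ⧸ Subgroup.zpowers τ) =
      Module.finrank Qbar (UnitsMod H × Qbar) := by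
    rw [← Nat.card_eq_fintype_card, card_S hH τ hτ2 hτ1, Module.finrank_prod, finrank_unitsMod,
      Module.finrank_self, Units.rank]
    have := Fintype.card_pos_iff.mpr ⟨InfinitePlace.mk ι⟩
    omega
  refine ⟨basisOfLinearIndependentOfCardEqFinrank li3 hfin, ?_⟩
  intro σ s
  simp only [coe_basisOfLinearIndependentOfCardEqFinrank, h1]
  simp [actA]

end aux

section cosets
variable {Γ : Type*} [Group Γ]

lemma coset_equiv (τ : Γ) (hτ2 : τ * τ = 1) (d : ℕ) (Gsub : Subgroup Γ) (h : Fin d → Γ)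
    (hreps : ∀ g : Γ, ∃! i : Fin d, (h i)⁻¹ * g ∈ Gsub)
    (hτi : ∀ i : Fin d, (h i)⁻¹ * τ * h i ∈ Gsub) :
    ∃ m : (Σ i : Fin d, (↥Gsub ⧸ Subgroup.zpowers (⟨(h i)⁻¹ * τ * h i, hτi i⟩ : ↥Gsub))) ≃
        (Γ ⧸ Subgroup.zpowers τ),
      ∀ (g : Gsub) i q, m ⟨i, g • q⟩ = (g : Γ) • m ⟨i, q⟩ := by
  have ht : ∀ i, (⟨(h i)⁻¹ * τ * h i, hτi i⟩ : ↥Gsub) * ⟨(h i)⁻¹ * τ * h i, hτi i⟩ = 1 := by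
    intro i
    ext
    have : (h i)⁻¹ * τ * h i * ((h i)⁻¹ * τ * h i) = (h i)⁻¹ * (τ * τ) * h i := by group
    simp only [Subgroup.coe_mul, this, hτ2]
    simp
  have rel : ∀ i (a b : Gsub), a⁻¹ * b ∈ Subgroup.zpowers (⟨(h i)⁻¹ * τ * h i, hτi i⟩ : ↥Gsub) ↔
      ((a : Γ) * (h i)⁻¹)⁻¹ * ((b : Γ) * (h i)⁻¹) ∈ Subgroup.zpowers τ := by
    intro i a b
    rw [zpowers_mem (ht i), zpowers_mem hτ2]
    have e : ((a : Γ) * (h i)⁻¹)⁻¹ * ((b : Γ) * (h i)⁻¹) = h i * ((a : Γ)⁻¹ * b) * (h i)⁻¹ := by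
      group
    rw [e, mul_inv_eq_iff_eq_mul, mul_inv_eq_iff_eq_mul, Subtype.ext_iff, Subtype.ext_iff]
    simp only [Subgroup.coe_mul, Subgroup.coe_inv, Subgroup.coe_one, one_mul, mul_assoc]
    refine or_congr ?_ ?_
    · rw [mul_eq_left]
    · rw [eq_inv_mul_iff_mul_eq]
  let m0 : (Σ i : Fin d, (↥Gsub ⧸ Subgroup.zpowers (⟨(h i)⁻¹ * τ * h i, hτi i⟩ : ↥Gsub))) →
      (Γ ⧸ Subgroup.zpowers τ) := fun x =>
    Quotient.lift (fun a : Gsub => (((a : Γ) * (h x.1)⁻¹ : Γ) : Γ ⧸ Subgroup.zpowers τ))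
      (fun a b hab => QuotientGroup.eq.mpr
        ((rel x.1 a b).mp (QuotientGroup.leftRel_apply.mp hab))) x.2
  have hm0 : ∀ i (a : Gsub), m0 ⟨i, (a : ↥Gsub ⧸ _)⟩ =
    (((a : Γ) * (h i)⁻¹ : Γ) : Γ ⧸ Subgroup.zpowers τ) := fun i a => rfl
  have hbij : Function.Bijective m0 := by
    constructor
    · rintro ⟨i, p⟩ ⟨j, q⟩ hpq
      obtain ⟨a, rfl⟩ := QuotientGroup.mk_surjective p
      obtain ⟨b, rfl⟩ := QuotientGroup.mk_surjective q
      rw [hm0, hm0, QuotientGroup.eq] at hpq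
      have hij : i = j := by
        have hc := (zpowers_mem hτ2).mp hpq
        have key : (h i)⁻¹ * h j ∈ Gsub := by
          rcases hc with hc | hc
          · have : (h i)⁻¹ * h j = (a : Γ)⁻¹ * b := by
              have e : (a : Γ) * (h i)⁻¹ = b * (h j)⁻¹ := inv_mul_eq_one.mp hc
              have e2 : (h i)⁻¹ = (a : Γ)⁻¹ * (b * (h j)⁻¹) := by rw [← e]; group
              rw [e2]; group
            rw [this]
            exact Gsub.mul_mem (Gsub.inv_mem a.2) b.2
          · have : (h i)⁻¹ * h j = ((h i)⁻¹ * τ * h i)⁻¹ * ((a : Γ)⁻¹ * b) := by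
              rw [← hc]; group
            rw [this]
            exact Gsub.mul_mem (Gsub.inv_mem (hτi i)) (Gsub.mul_mem (Gsub.inv_mem a.2) b.2)
        exact (hreps (h j)).unique key (by simp)
      subst hij
      congr 1
      rw [QuotientGroup.eq]
      exact (rel i a b).mpr hpq
    · intro s
      obtain ⟨σ, rfl⟩ := QuotientGroup.mk_surjective s
      obtain ⟨i, hi, -⟩ := hreps σ⁻¹
      refine ⟨⟨i, ((⟨_, Gsub.inv_mem hi⟩ : Gsub) : ↥Gsub ⧸ _)⟩, ?_⟩
      rw [hm0]
      congr 1
      simp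
  refine ⟨Equiv.ofBijective m0 hbij, ?_⟩
  intro g i q
  obtain ⟨a, rfl⟩ := QuotientGroup.mk_surjective q
  simp only [Equiv.ofBijective_apply]
  rw [MulAction.Quotient.smul_coe, hm0, hm0, MulAction.Quotient.smul_coe]
  congr 1
  simp [mul_assoc]

end cosets

/-- There is an isomorphism of `ℚ̄[G]`-modules
`(𝓞_H^× ⊗_ℤ ℚ̄) ⊕ ℚ̄ ≅ ⊕_{i=1}^d ℚ̄[G/⟨τᵢ⟩]`, where `ℚ̄` carries the trivial `G`-action
and `ℚ̄[G/⟨τᵢ⟩]` is the permutation module on the left cosets of `⟨τᵢ⟩ = {1, τᵢ}` with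
`G` acting by left translation.  The `ℚ̄[G]`-linearity is expressed by the displayed
equivariance property of the `ℚ̄`-linear equivalence `e`. -/
theorem stmt_5 (H : Type*) [Field H] [NumberField H] [IsGalois ℚ H]
    (hH : (H →+* ℝ) → False)
    (ι : H →+* ℂ) (τ : H ≃ₐ[ℚ] H)
    (hιτ : ∀ x : H, ι (τ x) = starRingEnd ℂ (ι x))
    (hτ2 : τ * τ = 1) (hτ1 : τ ≠ 1)
    -- `G = Gal(H/F)` for a totally real subfield `F ⊆ H` of degree `d`
    (d : ℕ) (hd : 0 < d)
    (Gsub : Subgroup (H ≃ₐ[ℚ] H)) (hGd : Gsub.index = d)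
    -- representatives of the left cosets of `G` in `Gal(H/ℚ)`, with `h 0 = 1`
    (h : Fin d → (H ≃ₐ[ℚ] H)) (hreps : ∀ g : H ≃ₐ[ℚ] H, ∃! i : Fin d, (h i)⁻¹ * g ∈ Gsub)
    (h1 : h ⟨0, hd⟩ = 1)
    -- `τᵢ = hᵢ⁻¹ τ hᵢ` lies in `G` (since `F` is totally real)
    (hτi : ∀ i : Fin d, (h i)⁻¹ * τ * h i ∈ Gsub) :
    ∃ e : (UnitsMod H × Qbar) ≃ₗ[Qbar]
        (∀ i : Fin d,
          (↥Gsub ⧸ Subgroup.zpowers (⟨(h i)⁻¹ * τ * h i, hτi i⟩ : ↥Gsub)) → Qbar),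
      ∀ (g : ↥Gsub) (x : UnitsMod H) (c : Qbar) (i : Fin d)
        (q : ↥Gsub ⧸ Subgroup.zpowers (⟨(h i)⁻¹ * τ * h i, hτi i⟩ : ↥Gsub)),
        e (actA H ↑g x, c) i q = e (x, c) i (g⁻¹ • q) := by
  classical
  obtain ⟨b, hb⟩ := exists_basis hH ι τ hιτ hτ2 hτ1
  obtain ⟨m, hm⟩ := coset_equiv τ hτ2 d Gsub h hreps hτi
  have hequiv : ∀ (σ : H ≃ₐ[ℚ] H) (y : UnitsMod H × Qbar) s,
      b.repr (actA H σ y.1, y.2) s = b.repr y (σ⁻¹ • s) := by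
    intro σ y s
    let L1 : (UnitsMod H × Qbar) →ₗ[Qbar] Qbar :=
      (b.coord s) ∘ₗ (LinearMap.prodMap (actA H σ) LinearMap.id)
    have hL : L1 = b.coord (σ⁻¹ • s) := by
      apply b.ext
      intro t
      have : L1 (b t) = b.repr (actA H σ (b t).1, (b t).2) s := rfl
      rw [this, hb, Module.Basis.coord_apply, b.repr_self, b.repr_self, Finsupp.single_apply,
        Finsupp.single_apply]
      simp only [eq_inv_smul_iff]
    exact congrArg (fun f => f y) hL
  have : Fintype ((H ≃ₐ[ℚ] H) ⧸ Subgroup.zpowers τ) := Fintype.ofFinite _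
  refine ⟨(b.equivFun.trans (LinearEquiv.funCongrLeft Qbar Qbar m)).trans
    (LinearEquiv.piCurry Qbar (fun _ _ => Qbar)), ?_⟩
  intro g x c i q
  change b.repr (actA H g x, c) (m ⟨i, q⟩) = b.repr (x, c) (m ⟨i, g⁻¹ • q⟩)
  rw [hm]
  exact hequiv g (x, c) _
end

section
/- For every irreducible ℚ̄-linear representation π of the finite group G, the multiplicity of π in 𝓞_H^× ⊗_ℤ ℚ̄ (that is, dim_ℚ̄ Hom_{ℚ̄[G]}(π, 𝓞_H^× ⊗_ℤ ℚ̄)) equals d − 1 if π is the trivial representation, and equals Σ_{i=1}^d dim_ℚ̄ {v ∈ π : τ_i · v = v} if π is nontrivial. -/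
open NumberField TensorProduct

/-- The space of `k`-linear maps `f : V → W` intertwining two actions `ρ`, `σg` of an
index type `G` and with image contained in a submodule `N`; for `N = ⊤` and group
actions this is the space `Hom_{k[G]}(V, W)`. -/
def intertwiners (k : Type*) [Field k] {G : Type*} (V W : Type*)
    [AddCommGroup V] [Module k V] [AddCommGroup W] [Module k W]
    (ρ : G → V →ₗ[k] V) (σg : G → W →ₗ[k] W) (N : Submodule k W) :
    Submodule k (V →ₗ[k] W) where
  carrier := {f | (∀ g : G, f ∘ₗ ρ g = σg g ∘ₗ f) ∧ ∀ v : V, f v ∈ N}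
  add_mem' := by
    rintro a b ⟨ha1, ha2⟩ ⟨hb1, hb2⟩
    refine ⟨fun g => ?_, fun v => N.add_mem (ha2 v) (hb2 v)⟩
    rw [LinearMap.add_comp, LinearMap.comp_add, ha1 g, hb1 g]
  zero_mem' := by
    refine ⟨fun g => ?_, fun v => N.zero_mem⟩
    rw [LinearMap.zero_comp, LinearMap.comp_zero]
  smul_mem' := by
    rintro c a ⟨ha1, ha2⟩
    refine ⟨fun g => ?_, fun v => N.smul_mem c (ha2 v)⟩
    rw [LinearMap.smul_comp, LinearMap.comp_smul, ha1 g]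

theorem invol_dim {k V : Type*} [Field k] [CharZero k] [AddCommGroup V] [Module k V]
    [FiniteDimensional k V] (t : V →ₗ[k] V) (ht : t ∘ₗ t = LinearMap.id) :
    (Module.finrank k V : k) + LinearMap.trace k V t =
      2 * (Module.finrank k (LinearMap.ker (t - LinearMap.id)) : k) := by
  have h2 : ∀ x, t (t x) = x := fun x => LinearMap.congr_fun ht x
  have hp : LinearMap.IsProj (LinearMap.ker (t - LinearMap.id))
      ((2⁻¹ : k) • (LinearMap.id + t)) := by
    refine ⟨fun x => ?_, fun x hx => ?_⟩
    · simp [h2, add_comm]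
    · have : t x = x := by simpa [sub_eq_zero] using hx
      rw [LinearMap.smul_apply, LinearMap.add_apply, LinearMap.id_apply, this, ← two_smul k x,
        smul_smul]
      simp
  rw [← hp.trace, map_smul, map_add, LinearMap.trace_id, smul_eq_mul]
  field_simp

theorem trace_perm {α : Type*} [Fintype α] [DecidableEq α] (s : α → α) :
    LinearMap.trace ℝ (α → ℝ) (LinearMap.funLeft ℝ ℝ s) =
      (Finset.univ.filter (fun a => s a = a)).card := by
  rw [LinearMap.trace_eq_matrix_trace ℝ (Pi.basisFun ℝ α)]
  simp [Matrix.trace, LinearMap.funLeft_apply, Pi.single_apply]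

theorem mkQ_bc_bij (A : Type*) [AddCommGroup A] (K : Type*) [Field K] [CharZero K] :
    Function.Bijective ((Submodule.torsion ℤ A).mkQ.baseChange K) := by
  set T := Submodule.torsion ℤ A
  have hzero : ∀ y : K ⊗[ℤ] T, y = 0 := by
    intro y
    induction y with
    | zero => rfl
    | add a b ha hb => rw [ha, hb, add_zero]
    | tmul a b =>
      obtain ⟨b, ⟨n, hn⟩⟩ := b
      have hn0 : ((n : ℤ) : K) ≠ 0 := by
        exact_mod_cast nonZeroDivisors.ne_zero n.2
      have ha : a = (n : ℤ) • (((n : ℤ) : K)⁻¹ * a) := by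
        rw [zsmul_eq_mul, mul_inv_cancel_left₀ hn0]
      rw [ha, TensorProduct.smul_tmul]
      have hb : (n : ℤ) • (⟨b, ⟨n, hn⟩⟩ : T) = 0 := Subtype.ext hn
      rw [hb, TensorProduct.tmul_zero]
  refine ⟨?_, LinearMap.lTensor_surjective K T.mkQ_surjective⟩
  rw [← LinearMap.ker_eq_bot, eq_bot_iff]
  intro x hx
  have hex := lTensor_exact K (f := T.subtype) (g := T.mkQ)
    (LinearMap.exact_subtype_mkQ T) T.mkQ_surjective
  obtain ⟨y, rfl⟩ := (hex x).1 hx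
  simp [hzero y]

theorem finrank_bc (A : Type*) [AddCommGroup A] [Module.Finite ℤ A] (K : Type*) [Field K]
    [CharZero K] : Module.finrank K (K ⊗[ℤ] A) = Module.finrank ℤ A := by
  rw [(LinearEquiv.ofBijective _ (mkQ_bc_bij A K)).finrank_eq, Module.finrank_baseChange]
  exact finrank_quotient_eq_of_le_torsion le_rfl

theorem trace_int {A : Type*} [AddCommGroup A] [Module.Finite ℤ A] (f : A →ₗ[ℤ] A) :
    ∃ n : ℤ, (LinearMap.trace ℝ _ (f.baseChange ℝ) = n) ∧
      (LinearMap.trace (AlgebraicClosure ℚ) _ (f.baseChange (AlgebraicClosure ℚ)) = n) := by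
  let T := Submodule.torsion ℤ A
  have hT : T ≤ T.comap f := by
    rintro x ⟨a, ha⟩
    refine ⟨a, ?_⟩
    have : (a : ℤ) • x = 0 := ha
    change (a : ℤ) • f x = 0
    rw [← map_smul, this, map_zero]
  let fb : (A ⧸ T) →ₗ[ℤ] (A ⧸ T) := T.mapQ T f hT
  have key : ∀ (K : Type) [Field K] [CharZero K],
      LinearMap.trace K _ (f.baseChange K) = (LinearMap.trace ℤ _ fb : ℤ) := by
    intro K _ _
    let e := LinearEquiv.ofBijective _ (mkQ_bc_bij A K)
    have : e.conj (f.baseChange K) = fb.baseChange K := by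
      apply LinearMap.ext
      intro x
      obtain ⟨y, rfl⟩ := e.surjective x
      rw [LinearEquiv.conj_apply_apply, e.symm_apply_apply]
      change (T.mkQ.baseChange K ∘ₗ f.baseChange K) y = (fb.baseChange K ∘ₗ T.mkQ.baseChange K) y
      rw [← LinearMap.baseChange_comp, ← LinearMap.baseChange_comp]
      rfl
    rw [← LinearMap.trace_conj' _ e, this, LinearMap.trace_baseChange]
    rfl
  exact ⟨_, key ℝ, key _⟩

/-- The full logarithmic embedding. -/
noncomputable def fullLog (H : Type*) [Field H] [NumberField H] :
    Additive ((𝓞 H)ˣ) →+ (InfinitePlace H → ℝ) where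
  toFun u w := w.mult * Real.log (w ((u.toMul : (𝓞 H)ˣ) : H))
  map_zero' := by ext w; simp
  map_add' a b := by
    ext w
    simp only [toMul_add, Units.coe_mul, map_mul, Pi.add_apply]
    rw [Real.log_mul, mul_add]
    all_goals simp

/-- Extension of the logarithmic embedding, with an added constant. -/
noncomputable def fullLogR (H : Type*) [Field H] [NumberField H] :
    (ℝ ⊗[ℤ] Additive ((𝓞 H)ˣ)) × ℝ →ₗ[ℝ] (InfinitePlace H → ℝ) :=
  LinearMap.coprod ((fullLog H).toIntLinearMap.liftBaseChange ℝ)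
    (LinearMap.toSpanSingleton ℝ _ (fun _ => 1))

theorem fullLogR_surj (H : Type*) [Field H] [NumberField H] :
    Function.Surjective (fullLogR H) := by
  classical
  set L := (fullLog H).toIntLinearMap.liftBaseChange ℝ with hL
  have hsum : ∀ x, ∑ w, L x w = 0 := by
    intro x
    induction x with
    | zero => simp
    | add a b ha hb => simp [Finset.sum_add_distrib, ha, hb]
    | tmul r u =>
      simp only [hL, LinearMap.liftBaseChange_tmul, Pi.smul_apply, smul_eq_mul, ← Finset.mul_sum]
      rw [mul_eq_zero]; right
      exact Units.sum_mult_mul_log u.toMul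
  let w₀ := Units.dirichletUnitTheorem.w₀ (K := H)
  have hoff : ∀ y : {w : InfinitePlace H // w ≠ w₀} → ℝ, ∃ x, ∀ w, L x w.1 = y w := by
    intro y
    have hy : y ∈ Submodule.span ℝ (Units.unitLattice H : Set (Units.dirichletUnitTheorem.logSpace H)) := by
      rw [Units.dirichletUnitTheorem.unitLattice_span_eq_top]; trivial
    induction hy using Submodule.span_induction with
    | mem z hz =>
      obtain ⟨u, -, rfl⟩ := hz
      exact ⟨1 ⊗ₜ u, fun w => by simp [hL, fullLog]; rfl⟩
    | zero => exact ⟨0, by simp⟩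
    | add a b _ _ ha hb =>
      obtain ⟨p, hp⟩ := ha
      obtain ⟨q, hq⟩ := hb
      exact ⟨p + q, fun w => by simp [hp, hq]⟩
    | smul r a _ ha =>
      obtain ⟨p, hp⟩ := ha
      exact ⟨r • p, fun w => by simp [hp]⟩
  intro f
  let c : ℝ := (∑ w, f w) / Fintype.card (InfinitePlace H)
  have hcard : (Fintype.card (InfinitePlace H) : ℝ) ≠ 0 := by simp
  have hf0 : ∑ w, (f w - c) = 0 := by
    simp only [Finset.sum_sub_distrib, Finset.sum_const, Finset.card_univ, nsmul_eq_mul, c]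
    field_simp
    ring
  obtain ⟨x, hx⟩ := hoff (fun w => f w.1 - c)
  refine ⟨(x, c), ?_⟩
  have hall : ∀ w, L x w = f w - c := by
    intro w
    by_cases hw : w = w₀
    · subst hw
      have h1 := hsum x
      rw [← Finset.add_sum_erase _ _ (Finset.mem_univ w₀)] at h1 hf0
      have : ∑ w ∈ Finset.univ.erase w₀, L x w = ∑ w ∈ Finset.univ.erase w₀, (f w - c) :=
        Finset.sum_congr rfl fun w hw => hx ⟨w, (Finset.mem_erase.1 hw).1⟩
      linarith
    · exact hx ⟨w, hw⟩
  ext w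
  change L x w + _ = _
  rw [hall]
  simp

theorem fullLogR_bij (H : Type*) [Field H] [NumberField H] :
    Function.Bijective (fullLogR H) := by
  refine ⟨?_, fullLogR_surj H⟩
  rw [LinearMap.injective_iff_surjective_of_finrank_eq_finrank]
  · exact fullLogR_surj H
  · rw [Module.finrank_prod, finrank_bc, Units.finrank_eq, Module.finrank_self,
      Module.finrank_pi, Units.rank]
    exact Nat.sub_add_cancel Fintype.card_pos

/-- The Galois action as an integral linear map. -/
noncomputable def actZ (H : Type*) [Field H] [NumberField H] (g : H ≃ₐ[ℚ] H) :
    Additive ((𝓞 H)ˣ) →ₗ[ℤ] Additive ((𝓞 H)ˣ) :=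
  AddMonoidHom.toIntLinearMap (AddEquiv.toAddMonoidHom (MulEquiv.toAdditive (galU H g)))

theorem galU_coe (H : Type*) [Field H] [NumberField H] (g : H ≃ₐ[ℚ] H) (u : (𝓞 H)ˣ) :
    ((galU H g u : (𝓞 H)ˣ) : H) = g (u : H) := by
  change algebraMap (𝓞 H) H (galRestrict ℤ ℚ H (𝓞 H) g u) = _
  rw [algebraMap_galRestrict_apply]

theorem fullLog_act (H : Type*) [Field H] [NumberField H] (g : H ≃ₐ[ℚ] H)
    (u : Additive ((𝓞 H)ˣ)) (w : InfinitePlace H) :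
    fullLog H (actZ H g u) w = fullLog H u (g⁻¹ • w) := by
  change (w.mult : ℝ) * Real.log (w ((galU H g u.toMul : (𝓞 H)ˣ) : H)) =
    (g⁻¹ • w).mult * Real.log ((g⁻¹ • w) ((u.toMul : (𝓞 H)ˣ) : H))
  rw [galU_coe, InfinitePlace.smul_apply]
  congr 1
  have := InfinitePlace.isReal_smul_iff (σ := g⁻¹) (w := w)
  by_cases hw : w.IsReal
  · simp [InfinitePlace.mult, hw, this.2 hw]
  · simp [InfinitePlace.mult, hw, mt this.1 hw]

theorem trace_actA (H : Type*) [Field H] [NumberField H] [DecidableEq (InfinitePlace H)]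
    (g : H ≃ₐ[ℚ] H) :
    LinearMap.trace Qbar _ (actA H g) + 1 =
      ((Finset.univ.filter (fun w : InfinitePlace H => g • w = w)).card : Qbar) := by
  obtain ⟨n, hR, hQ⟩ := trace_int (actZ H g)
  have hQ' : LinearMap.trace Qbar _ (actA H g) = n := hQ
  let e := LinearEquiv.ofBijective _ (fullLogR_bij H)
  have hconj : e.conj (((actZ H g).baseChange ℝ).prodMap LinearMap.id) =
      LinearMap.funLeft ℝ ℝ (fun w : InfinitePlace H => g⁻¹ • w) := by
    apply LinearMap.ext
    intro x
    obtain ⟨⟨y, c⟩, rfl⟩ := e.surjective x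
    rw [LinearEquiv.conj_apply_apply, e.symm_apply_apply]
    ext w
    change (fullLogR H ((actZ H g).baseChange ℝ y, c)) w = (fullLogR H (y, c)) (g⁻¹ • w)
    simp only [fullLogR, LinearMap.coprod_apply, Pi.add_apply]
    congr 1
    induction y with
    | zero => simp
    | add a b ha hb => simp only [map_add, Pi.add_apply, ha, hb]
    | tmul r u =>
      simp only [LinearMap.baseChange_tmul, LinearMap.liftBaseChange_tmul, Pi.smul_apply]
      congr 1
      exact fullLog_act H g u w
  have ht := trace_perm (fun w : InfinitePlace H => g⁻¹ • w)
  rw [← hconj, LinearMap.trace_conj', LinearMap.trace_prodMap', hR, LinearMap.trace_id,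
    Module.finrank_self] at ht
  have hset : (Finset.univ.filter (fun w : InfinitePlace H => g⁻¹ • w = w)) =
      Finset.univ.filter (fun w : InfinitePlace H => g • w = w) := by
    ext w
    simp only [Finset.mem_filter, Finset.mem_univ, true_and]
    rw [inv_smul_eq_iff, eq_comm]
  rw [hset] at ht
  rw [hQ']
  exact_mod_cast ht

theorem two_fix (H : Type*) [Field H] [NumberField H] [IsGalois ℚ H]
    [DecidableEq (InfinitePlace H)] [DecidableEq (H ≃ₐ[ℚ] H)]
    (ι : H →+* ℂ) (τ : H ≃ₐ[ℚ] H)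
    (hιτ : ∀ x : H, ι (τ x) = starRingEnd ℂ (ι x)) (hτ1 : τ ≠ 1) (g : H ≃ₐ[ℚ] H) :
    (Finset.univ.filter (fun w : InfinitePlace H => g • w = w)).card * 2 =
      ∑ a : H ≃ₐ[ℚ] H, ((if g = 1 then 1 else 0) + (if g = a⁻¹ * τ * a then 1 else 0)) := by
  let w0 := InfinitePlace.mk ι
  have hconj : ComplexEmbedding.IsConj ι τ := by
    ext x
    exact (hιτ x).symm
  have hstab : ∀ σ : H ≃ₐ[ℚ] H, σ • w0 = w0 ↔ σ = 1 ∨ σ = τ := by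
    intro σ
    have := Set.ext_iff.1 hconj.coe_stabilizer_mk σ
    exact this
  have htrans : ∀ w : InfinitePlace H, ∃ b : H ≃ₐ[ℚ] H, b⁻¹ • w0 = w := by
    intro w
    have : w ∈ MulAction.orbit (H ≃ₐ[ℚ] H) w0 :=
      InfinitePlace.mem_orbit_iff.2 (Subsingleton.elim _ _)
    obtain ⟨b, hb⟩ := this
    exact ⟨b⁻¹, by simpa using hb⟩
  have hfib : ∀ w : InfinitePlace H,
      (Finset.univ.filter (fun a : H ≃ₐ[ℚ] H => a⁻¹ • w0 = w)).card = 2 := by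
    intro w
    obtain ⟨b, rfl⟩ := htrans w
    have : Finset.univ.filter (fun a : H ≃ₐ[ℚ] H => a⁻¹ • w0 = b⁻¹ • w0) = {b, τ⁻¹ * b} := by
      ext a
      have e : a⁻¹ • w0 = b⁻¹ • w0 ↔ (b * a⁻¹) • w0 = w0 := by
        rw [mul_smul, eq_inv_smul_iff]
      simp only [Finset.mem_filter, Finset.mem_univ, true_and, Finset.mem_insert,
        Finset.mem_singleton, e, hstab]
      constructor
      · rintro (h | h)
        · left; exact (mul_inv_eq_one.1 h).symm
        · right; rw [← h]; group
      · rintro (h | h)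
        · left; rw [h]; group
        · right; rw [h]; group
    rw [this, Finset.card_pair]
    intro h
    apply hτ1
    have := mul_eq_right.1 h.symm
    simpa using this
  have hcount : (Finset.univ.filter
      (fun a : H ≃ₐ[ℚ] H => g • (a⁻¹ • w0) = a⁻¹ • w0)).card =
      (Finset.univ.filter (fun w : InfinitePlace H => g • w = w)).card * 2 := by
    rw [Finset.card_eq_sum_card_fiberwise (f := fun a : H ≃ₐ[ℚ] H => a⁻¹ • w0)
      (t := Finset.univ.filter (fun w : InfinitePlace H => g • w = w))]
    · rw [Finset.sum_const_nat]
      intro w hw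
      rw [← hfib w, Finset.filter_filter]
      congr 1
      ext a
      simp only [Finset.mem_filter, Finset.mem_univ, true_and] at hw ⊢
      constructor
      · exact fun h => h.2
      · rintro rfl
        exact ⟨hw, rfl⟩
    · intro a ha
      simpa using ha
  rw [← hcount, Finset.card_filter]
  refine Finset.sum_congr rfl fun a _ => ?_
  have e : g • (a⁻¹ • w0) = a⁻¹ • w0 ↔ g = 1 ∨ g = a⁻¹ * τ * a := by
    rw [eq_inv_smul_iff, ← mul_smul, ← mul_smul, hstab]
    constructor
    · rintro (h | h)
      · left
        have : g = a⁻¹ * (a * g * a⁻¹) * a := by group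
        rw [this, h]; group
      · right
        rw [← h]; group
    · rintro (h | h)
      · left; rw [h]; group
      · right; rw [h]; group
  by_cases h1 : g = 1
  · have h2 : ¬ g = a⁻¹ * τ * a := by
      intro h2
      apply hτ1
      have : τ = a * (a⁻¹ * τ * a) * a⁻¹ := by group
      rw [this, ← h2, h1]; group
    rw [if_pos (e.2 (Or.inl h1)), if_pos h1, if_neg h2]
  · by_cases h2 : g = a⁻¹ * τ * a
    · rw [if_pos (e.2 (Or.inr h2)), if_neg h1, if_pos h2]
    · rw [if_neg (fun h => (e.1 h).elim h1 h2), if_neg h1, if_neg h2]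

/-- The representation of the Galois group on the units. -/
noncomputable def unitsRep (H : Type*) [Field H] [NumberField H] :
    Representation Qbar (H ≃ₐ[ℚ] H) (UnitsMod H) where
  toFun g := actA H g
  map_one' := by
    have : actZ H 1 = LinearMap.id := by
      refine LinearMap.ext fun u => ?_
      apply Additive.toMul.injective
      apply Units.coe_injective H
      exact galU_coe H 1 u.toMul
    change (actZ H 1).baseChange Qbar = _
    rw [this, LinearMap.baseChange_id]
    rfl
  map_mul' g g' := by
    have : actZ H (g * g') = actZ H g ∘ₗ actZ H g' := by
      refine LinearMap.ext fun u => ?_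
      apply Additive.toMul.injective
      apply Units.coe_injective H
      change ((galU H (g * g') u.toMul : (𝓞 H)ˣ) : H) = ((galU H g (galU H g' u.toMul) : (𝓞 H)ˣ) : H)
      rw [galU_coe, galU_coe, galU_coe]
      rfl
    change (actZ H (g * g')).baseChange Qbar = _
    rw [this, LinearMap.baseChange_comp]
    rfl

theorem main_count (H : Type*) [Field H] [NumberField H] [IsGalois ℚ H]
    (ι : H →+* ℂ) (τ : H ≃ₐ[ℚ] H)
    (hιτ : ∀ x : H, ι (τ x) = starRingEnd ℂ (ι x))
    (hτ2 : τ * τ = 1) (hτ1 : τ ≠ 1)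
    (d : ℕ)
    (Gsub : Subgroup (H ≃ₐ[ℚ] H))
    (h : Fin d → (H ≃ₐ[ℚ] H)) (hreps : ∀ g : H ≃ₐ[ℚ] H, ∃! i : Fin d, (h i)⁻¹ * g ∈ Gsub)
    (hτi : ∀ i : Fin d, (h i)⁻¹ * τ * h i ∈ Gsub)
    (V : Type*) [AddCommGroup V] [Module Qbar V] [FiniteDimensional Qbar V]
    (ρ : Representation Qbar ↥Gsub V) :
    Module.finrank Qbar
        ↥(intertwiners Qbar V (UnitsMod H)
            (fun g : ↥Gsub => ρ g) (fun g : ↥Gsub => actA H ↑g) ⊤) +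
      Module.finrank Qbar ρ.invariants =
      ∑ i : Fin d,
        Module.finrank Qbar
          ↥(LinearMap.ker
              (ρ (⟨(h i)⁻¹ * τ * h i, hτi i⟩ : ↥Gsub) - LinearMap.id)) := by
  classical
  let σ : Representation Qbar ↥Gsub (UnitsMod H) := (unitsRep H).comp Gsub.subtype
  have hI : intertwiners Qbar V (UnitsMod H)
      (fun g : ↥Gsub => ρ g) (fun g : ↥Gsub => actA H ↑g) ⊤ =
      (Representation.linHom ρ σ).invariants := by
    ext f
    rw [Representation.mem_invariants]
    change ((∀ g : ↥Gsub, f ∘ₗ ρ g = σ g ∘ₗ f) ∧ ∀ v : V, f v ∈ (⊤ : Submodule _ _)) ↔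
      ∀ g : ↥Gsub, σ g ∘ₗ f ∘ₗ ρ g⁻¹ = f
    simp only [Submodule.mem_top, implies_true, and_true]
    refine forall_congr' fun g => ⟨fun e => ?_, fun e => ?_⟩
    · rw [← LinearMap.comp_assoc, ← e]
      ext v; simp
    · nth_rewrite 1 [← e]
      ext v; simp
  have hN : (Nat.card Gsub : Qbar) ≠ 0 := by
    exact_mod_cast Nat.card_pos.ne'
  let _ : Invertible (Nat.card Gsub : Qbar) := invertibleOfNonzero hN
  have c1 := Representation.card_inv_mul_sum_char_eq_finrank (Representation.linHom ρ σ)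
  have c2 := Representation.card_inv_mul_sum_char_eq_finrank ρ
  rw [inv_mul_eq_iff_eq_mul₀ hN] at c1 c2
  simp only [Representation.char_linHom] at c1
  rw [← Equiv.sum_comp (Equiv.inv Gsub)] at c2
  simp only [Equiv.inv_apply] at c2
  let t : Fin d → Gsub := fun i => ⟨(h i)⁻¹ * τ * h i, hτi i⟩
  have ht2 : ∀ i, t i * t i = 1 := by
    intro i
    apply Subtype.ext
    change (h i)⁻¹ * τ * h i * ((h i)⁻¹ * τ * h i) = 1
    calc _ = (h i)⁻¹ * (τ * τ) * h i := by group
      _ = 1 := by rw [hτ2]; group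
  -- reindexing
  let E : Fin d × Gsub → (H ≃ₐ[ℚ] H) := fun p => h p.1 * p.2
  have hE : Function.Bijective E := by
    constructor
    · rintro ⟨i, a⟩ ⟨j, b⟩ hab
      change h i * a = h j * b at hab
      have hij : i = j := by
        apply (hreps (h i * a)).unique
        · simp
        · rw [hab]; simp
      subst hij
      simpa using hab
    · intro g
      obtain ⟨i, hi, -⟩ := hreps g
      exact ⟨(i, ⟨_, hi⟩), by simp [E]⟩
  have hchar : ∀ g : Gsub, (σ.character g + 1) * 2 =
      ∑ i : Fin d, ∑ γ : Gsub, ((if g = 1 then (1 : Qbar) else 0) +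
        (if g = γ⁻¹ * t i * γ then 1 else 0)) := by
    intro g
    have e1 : σ.character g + 1 = _ := trace_actA H (g : H ≃ₐ[ℚ] H)
    have e2 := two_fix H ι τ hιτ hτ1 (g : H ≃ₐ[ℚ] H)
    rw [← hE.sum_comp, Fintype.sum_prod_type] at e2
    rw [e1]
    have e3 := congrArg (Nat.cast : ℕ → Qbar) e2
    push_cast at e3
    rw [e3]
    refine Finset.sum_congr rfl fun i _ => Finset.sum_congr rfl fun γ _ => ?_
    have k1 : (g : H ≃ₐ[ℚ] H) = 1 ↔ g = 1 := by simp
    have k2 : (g : H ≃ₐ[ℚ] H) = (E (i, γ))⁻¹ * τ * E (i, γ) ↔ g = γ⁻¹ * t i * γ := by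
      rw [Subtype.ext_iff]
      simp [E, t, mul_assoc]
    simp only [k1, k2]
  have hsum : (∑ g : Gsub, ρ.character g⁻¹ * σ.character g + ∑ g : Gsub, ρ.character g⁻¹) * 2 =
      ∑ i : Fin d, (Nat.card Gsub : Qbar) * (2 * (Module.finrank Qbar
          ↥(LinearMap.ker (ρ (t i) - LinearMap.id)) : Qbar)) := by
    calc _ = ∑ g : Gsub, ρ.character g⁻¹ * ((σ.character g + 1) * 2) := by
          rw [← Finset.sum_add_distrib, Finset.sum_mul]
          exact Finset.sum_congr rfl fun g _ => by ring
      _ = ∑ i : Fin d, ∑ γ : Gsub, ∑ g : Gsub, ρ.character g⁻¹ *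
            ((if g = 1 then (1 : Qbar) else 0) + (if g = γ⁻¹ * t i * γ then 1 else 0)) := by
          simp only [hchar, Finset.mul_sum]
          rw [Finset.sum_comm]
          exact Finset.sum_congr rfl fun i _ => Finset.sum_comm
      _ = _ := by
          refine Finset.sum_congr rfl fun i _ => ?_
          have : ∀ γ : Gsub, ∑ g : Gsub, ρ.character g⁻¹ *
            ((if g = 1 then (1 : Qbar) else 0) + (if g = γ⁻¹ * t i * γ then 1 else 0)) =
              2 * (Module.finrank Qbar
                ↥(LinearMap.ker (ρ (t i) - LinearMap.id)) : Qbar) := by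
            intro γ
            have hinv : (γ⁻¹ * t i * γ)⁻¹ = γ⁻¹ * t i * γ⁻¹⁻¹ := by
              have : (t i)⁻¹ = t i := inv_eq_of_mul_eq_one_left (ht2 i)
              simp [mul_assoc, this]
            simp only [mul_add, mul_ite, mul_one, mul_zero, Finset.sum_add_distrib,
              Finset.sum_ite_eq', Finset.mem_univ, if_true]
            rw [hinv, Representation.char_conj, inv_one, Representation.char_one]
            apply invol_dim
            have := ρ.map_mul (t i) (t i)
            rw [ht2, map_one] at this
            exact this.symm
          simp only [this, Finset.sum_const, Finset.card_univ, nsmul_eq_mul, Nat.card_eq_fintype_card]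
  rw [c1, c2, ← Finset.mul_sum, ← Finset.mul_sum, ← mul_add, mul_assoc] at hsum
  have hfin := mul_left_cancel₀ hN hsum
  rw [mul_comm] at hfin
  have hfin := mul_left_cancel₀ (two_ne_zero) hfin
  rw [hI]
  exact_mod_cast hfin

/-- For every irreducible `ℚ̄`-linear representation `π = (V, ρ)` of
`G`, the multiplicity of `π` in `𝓞_H^× ⊗_ℤ ℚ̄`, i.e. `dim Hom_{ℚ̄[G]}(π, 𝓞_H^× ⊗ ℚ̄)`,
equals `d - 1` if `π` is trivial, and `∑_{i=1}^d dim {v ∈ π : τᵢ v = v}` otherwise. -/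
theorem stmt_6 (H : Type*) [Field H] [NumberField H] [IsGalois ℚ H]
    (hH : (H →+* ℝ) → False)
    (ι : H →+* ℂ) (τ : H ≃ₐ[ℚ] H)
    (hιτ : ∀ x : H, ι (τ x) = starRingEnd ℂ (ι x))
    (hτ2 : τ * τ = 1) (hτ1 : τ ≠ 1)
    -- `G = Gal(H/F)` for a totally real subfield `F ⊆ H` of degree `d`
    (d : ℕ) (hd : 0 < d)
    (Gsub : Subgroup (H ≃ₐ[ℚ] H)) (hGd : Gsub.index = d)
    -- representatives of the left cosets of `G` in `Gal(H/ℚ)`, with `h 0 = 1`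
    (h : Fin d → (H ≃ₐ[ℚ] H)) (hreps : ∀ g : H ≃ₐ[ℚ] H, ∃! i : Fin d, (h i)⁻¹ * g ∈ Gsub)
    (h1 : h ⟨0, hd⟩ = 1)
    -- `τᵢ = hᵢ⁻¹ τ hᵢ` lies in `G` (since `F` is totally real)
    (hτi : ∀ i : Fin d, (h i)⁻¹ * τ * h i ∈ Gsub)
    -- an irreducible `ℚ̄`-linear representation `π = (V, ρ)` of `G`
    (V : Type*) [AddCommGroup V] [Module Qbar V] [FiniteDimensional Qbar V] [Nontrivial V]
    (ρ : Representation Qbar ↥Gsub V)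
    (hirr : ∀ W : Submodule Qbar V, (∀ g : ↥Gsub, ∀ v ∈ W, ρ g v ∈ W) → W = ⊥ ∨ W = ⊤) :
    ((∀ g : ↥Gsub, ρ g = LinearMap.id) →
      Module.finrank Qbar
        ↥(intertwiners Qbar V (UnitsMod H)
            (fun g : ↥Gsub => ρ g) (fun g : ↥Gsub => actA H ↑g) ⊤) = d - 1) ∧
    ((¬ ∀ g : ↥Gsub, ρ g = LinearMap.id) →
      Module.finrank Qbar
        ↥(intertwiners Qbar V (UnitsMod H)
            (fun g : ↥Gsub => ρ g) (fun g : ↥Gsub => actA H ↑g) ⊤) =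
      ∑ i : Fin d,
        Module.finrank Qbar
          ↥(LinearMap.ker
              (ρ (⟨(h i)⁻¹ * τ * h i, hτi i⟩ : ↥Gsub) - LinearMap.id))) := by
  have key := main_count H ι τ hιτ hτ2 hτ1 d Gsub h hreps hτi V ρ
  constructor
  · intro htriv
    have hinv : ρ.invariants = ⊤ := by
      rw [eq_top_iff]
      intro v _ g
      rw [htriv g]; rfl
    have hker : ∀ i, LinearMap.ker
        (ρ (⟨(h i)⁻¹ * τ * h i, hτi i⟩ : ↥Gsub) - LinearMap.id) = ⊤ := by
      intro i
      rw [htriv, sub_self, LinearMap.ker_zero]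
    have hone : Module.finrank Qbar V = 1 := by
      obtain ⟨v, hv⟩ := exists_ne (0 : V)
      rcases hirr (Submodule.span Qbar {v}) (fun g x hx => by rw [htriv g]; exact hx) with h0 | h0
      · exact absurd (Submodule.span_singleton_eq_bot.1 h0) hv
      · rw [← finrank_top Qbar V, ← h0, finrank_span_singleton hv]
    have hker' : ∀ i, Module.finrank Qbar (LinearMap.ker
        (ρ (⟨(h i)⁻¹ * τ * h i, hτi i⟩ : ↥Gsub) - LinearMap.id)) = 1 := by
      intro i
      rw [hker, finrank_top, hone]
    rw [hinv, finrank_top, hone, Finset.sum_congr rfl (fun i _ => hker' i)] at key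
    simp only [Finset.sum_const, Finset.card_univ, Fintype.card_fin, smul_eq_mul, mul_one] at key
    omega
  · intro hnt
    have hinv : ρ.invariants = ⊥ := by
      rcases hirr ρ.invariants (fun g x hx => by rw [hx g]; exact hx) with h0 | h0
      · exact h0
      · exfalso
        apply hnt
        intro g
        ext v
        have : v ∈ ρ.invariants := by rw [h0]; trivial
        exact this g
    rw [hinv, finrank_bot, add_zero] at key
    exact key
end
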